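/- There is no Π⁰₂ equivalence relation E on ℕ such that every Π⁰₂ equivalence relation on ℕ is computably reducible to E. (That is, there is no Π⁰₂-complete equivalence relation under computable reducibility.) -/

import Mathlib

/-- `E` is computably reducible to `F`. -/
def ComputablyReducible (E F : ℕ → ℕ → Prop) : Prop :=
  ∃ f : ℕ → ℕ, Computable f ∧ ∀ x y, E x y ↔ F (f x) (f y)

/-- A binary relation on ℕ is Π⁰₂. -/
def Pi02Rel (E : ℕ → ℕ → Prop) : Prop :=
  ∃ R : ℕ → ℕ → ℕ → ℕ → Bool,
    Computable (fun p : ℕ × ℕ × ℕ × ℕ => R p.1 p.2.1 p.2.2.1 p.2.2.2) ∧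
    ∀ x y, E x y ↔ ∀ s, ∃ t, R x y s t = true

open Nat.Partrec (Code)
open Nat.Partrec.Code (evaln eval evaln_mono evaln_sound evaln_complete exists_code primrec_evaln)

/-- The kernel of a limit-computable function is `Π⁰₂`. -/
theorem pi02Rel_of_limit {χ : ℕ → ℕ} {g : ℕ → ℕ → ℕ} (hg : Computable₂ g)
    (hlim : ∀ z, ∃ N, ∀ n ≥ N, g z n = χ z) : Pi02Rel (fun x y => χ x = χ y) := by
  refine ⟨fun x y s t => decide (g x (s + t) = g y (s + t)), ?_, fun x y => ?_⟩
  · have hadd : Computable (fun p : ℕ × ℕ × ℕ × ℕ => p.2.2.1 + p.2.2.2) :=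
      Primrec.to_comp (Primrec.nat_add.comp
        (Primrec.fst.comp (Primrec.snd.comp Primrec.snd))
        (Primrec.snd.comp (Primrec.snd.comp Primrec.snd)))
    exact (Primrec.eq (α := ℕ)).decide.to_comp.comp (hg.comp Computable.fst hadd)
      (hg.comp (Computable.fst.comp Computable.snd) hadd)
  · obtain ⟨M, hM⟩ := hlim x
    obtain ⟨N, hN⟩ := hlim y
    simp only [decide_eq_true_eq]
    constructor
    · intro h s
      exact ⟨M + N, by rw [hM _ (by omega), hN _ (by omega), h]⟩
    · intro h
      obtain ⟨t, ht⟩ := h (M + N)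
      rwa [hM _ (by omega), hN _ (by omega)] at ht

/-- The state `(i, t)` after `n` steps of the search for the least row `i` of `v` that is
constantly `false`: the search is testing entry `t` of row `i`. -/
def rowSearch (v : ℕ → ℕ → Bool) (n : ℕ) : ℕ × ℕ :=
  Nat.rec (0, 0) (fun _ s => bif v s.1 s.2 then (s.1 + 1, 0) else (s.1, s.2 + 1)) n

theorem rowSearch_succ (v : ℕ → ℕ → Bool) (n : ℕ) :
    rowSearch v (n + 1) = bif v (rowSearch v n).1 (rowSearch v n).2
      then ((rowSearch v n).1 + 1, 0) else ((rowSearch v n).1, (rowSearch v n).2 + 1) := rfl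

theorem rowSearch_add {v : ℕ → ℕ → Bool} {N i k : ℕ} (hN : rowSearch v N = (i, 0))
    (hk : ∀ t < k, v i t = false) : rowSearch v (N + k) = (i, k) := by
  induction k with
  | zero => exact hN
  | succ k ih =>
    have h := ih fun t ht => hk t (by omega)
    rw [← Nat.add_assoc, rowSearch_succ, h]
    simp [hk k (by omega)]

theorem rowSearch_eventually_eq {v : ℕ → ℕ → Bool} {i : ℕ} (hi : ∀ t, v i t = false)
    (hlt : ∀ j < i, ∃ t, v j t = true) : ∃ N, ∀ n ≥ N, (rowSearch v n).1 = i := by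
  have reach : ∀ j ≤ i, ∃ N, rowSearch v N = (j, 0) := by
    intro j
    induction j with
    | zero => exact fun _ => ⟨0, rfl⟩
    | succ j ih =>
      intro hj
      obtain ⟨N, hN⟩ := ih (by omega)
      have hex := hlt j (by omega)
      have h := rowSearch_add hN (k := Nat.find hex) fun t ht => by
        simpa using Nat.find_min hex ht
      exact ⟨N + Nat.find hex + 1, by rw [rowSearch_succ, h]; simp [Nat.find_spec hex]⟩
  obtain ⟨N, hN⟩ := reach i le_rfl
  refine ⟨N, fun n hn => ?_⟩
  obtain ⟨k, rfl⟩ := Nat.exists_eq_add_of_le hn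
  rw [rowSearch_add hN fun t _ => hi t]

theorem computable_rowSearch {V : ℕ → ℕ → ℕ → Bool}
    (hV : Computable (fun p : ℕ × ℕ × ℕ => V p.1 p.2.1 p.2.2)) :
    Computable₂ (fun z n => rowSearch (V z) n) := by
  have hs : Computable (fun q : (ℕ × ℕ) × ℕ × (ℕ × ℕ) => q.2.2) :=
    Computable.snd.comp Computable.snd
  have hz : Computable (fun q : (ℕ × ℕ) × ℕ × (ℕ × ℕ) => q.1.1) :=
    Computable.fst.comp Computable.fst
  have hi : Computable (fun q : (ℕ × ℕ) × ℕ × (ℕ × ℕ) => q.2.2.1) := Computable.fst.comp hs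
  have ht : Computable (fun q : (ℕ × ℕ) × ℕ × (ℕ × ℕ) => q.2.2.2) := Computable.snd.comp hs
  have hv := hV.comp (hz.pair hs)
  have hstep : Computable₂ (fun (p : ℕ × ℕ) (q : ℕ × (ℕ × ℕ)) =>
      bif V p.1 q.2.1 q.2.2 then (q.2.1 + 1, 0) else (q.2.1, q.2.2 + 1)) :=
    Computable.cond hv ((Computable.succ.comp hi).pair (Computable.const 0))
      (hi.pair (Computable.succ.comp ht))
  have hrec := Computable.nat_rec Computable.snd (Computable.const ((0, 0) : ℕ × ℕ)) hstep
  exact Computable.of_eq hrec fun _ => rfl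

/-- The table used to diagonalize against the `e`-th partial computable function `φ` on the
column of numbers `z = ⟨e, m⟩`. For `m < 2` its least `false` row is `m`. For `m ≥ 2`, with
`a, b, c` the values of `φ` at `⟨e, 0⟩, ⟨e, 1⟩, z`, row `2 * s` (resp. `2 * s + 1`) is `false` if
`s` witnesses that `c` is inequivalent to `a` (resp. `b`); also row `i` is `false` if `i` refutes
that `m - 2` witnesses the inequivalence of `a` and `b`. -/
def diagTable (R : ℕ → ℕ → ℕ → ℕ → Bool) (z i t : ℕ) : Bool :=
  bif decide (z.unpair.2 < 2) then decide (i < z.unpair.2) else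
    ((evaln t.unpair.1 (Denumerable.ofNat Code z.unpair.1) (Nat.pair z.unpair.1 0)).bind fun a =>
      (evaln t.unpair.1 (Denumerable.ofNat Code z.unpair.1) (Nat.pair z.unpair.1 1)).bind fun b =>
        (evaln t.unpair.1 (Denumerable.ofNat Code z.unpair.1) z).map fun c =>
          R c (bif decide (i % 2 = 0) then a else b) (i / 2) t.unpair.2 &&
            !R a b (z.unpair.2 - 2) i).getD false

theorem computable_diagTable {R : ℕ → ℕ → ℕ → ℕ → Bool}
    (hR : Computable (fun p : ℕ × ℕ × ℕ × ℕ => R p.1 p.2.1 p.2.2.1 p.2.2.2)) :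
    Computable (fun p : ℕ × ℕ × ℕ => diagTable R p.1 p.2.1 p.2.2) := by
  have hz : Primrec (fun p : ℕ × ℕ × ℕ => p.1) := Primrec.fst
  have hi : Primrec (fun p : ℕ × ℕ × ℕ => p.2.1) := Primrec.fst.comp Primrec.snd
  have ht : Primrec (fun p : ℕ × ℕ × ℕ => p.2.2) := Primrec.snd.comp Primrec.snd
  have he : Primrec (fun p : ℕ × ℕ × ℕ => p.1.unpair.1) :=
    Primrec.fst.comp (Primrec.unpair.comp hz)
  have hm : Primrec (fun p : ℕ × ℕ × ℕ => p.1.unpair.2) :=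
    Primrec.snd.comp (Primrec.unpair.comp hz)
  have hk : Primrec (fun p : ℕ × ℕ × ℕ => p.2.2.unpair.1) :=
    Primrec.fst.comp (Primrec.unpair.comp ht)
  have hu : Primrec (fun p : ℕ × ℕ × ℕ => p.2.2.unpair.2) :=
    Primrec.snd.comp (Primrec.unpair.comp ht)
  have hev : ∀ {x : ℕ × ℕ × ℕ → ℕ}, Primrec x → Computable (fun p : ℕ × ℕ × ℕ =>
      evaln p.2.2.unpair.1 (Denumerable.ofNat Code p.1.unpair.1) (x p)) := fun hx =>
    (primrec_evaln.comp ((hk.pair ((Primrec.ofNat Code).comp he)).pair hx)).to_comp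
  refine Computable.cond (PrimrecPred.decide (Primrec.nat_lt.comp hm (Primrec.const 2))).to_comp
    (PrimrecPred.decide (Primrec.nat_lt.comp hi hm)).to_comp ?_
  refine Computable.option_getD (Computable.option_bind
    (hev (Primrec₂.natPair.comp he (Primrec.const 0))) ?_) (Computable.const false)
  refine Computable.option_bind
    ((hev (Primrec₂.natPair.comp he (Primrec.const 1))).comp Computable.fst) ?_
  refine Computable.option_map
    ((hev hz).comp (Computable.fst.comp Computable.fst)) ?_
  have hp : Primrec (fun q : (((ℕ × ℕ × ℕ) × ℕ) × ℕ) × ℕ => q.1.1.1) :=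
    Primrec.fst.comp (Primrec.fst.comp Primrec.fst)
  have ha : Primrec (fun q : (((ℕ × ℕ × ℕ) × ℕ) × ℕ) × ℕ => q.1.1.2) :=
    Primrec.snd.comp (Primrec.fst.comp Primrec.fst)
  have hb : Primrec (fun q : (((ℕ × ℕ × ℕ) × ℕ) × ℕ) × ℕ => q.1.2) :=
    Primrec.snd.comp Primrec.fst
  have hc : Primrec (fun q : (((ℕ × ℕ × ℕ) × ℕ) × ℕ) × ℕ => q.2) := Primrec.snd
  have hpar : Primrec (fun p : ℕ × ℕ × ℕ => decide (p.2.1 % 2 = 0)) :=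
    PrimrecPred.decide (Primrec.eq.comp (Primrec.nat_mod.comp hi (Primrec.const 2))
      (Primrec.const 0))
  have hsel : Primrec (fun q : (((ℕ × ℕ × ℕ) × ℕ) × ℕ) × ℕ =>
      bif decide (q.1.1.1.2.1 % 2 = 0) then q.1.1.2 else q.1.2) :=
    Primrec.cond (hpar.comp hp) ha hb
  have hhalf : Primrec (fun q : (((ℕ × ℕ × ℕ) × ℕ) × ℕ) × ℕ => q.1.1.1.2.1 / 2) :=
    Primrec.nat_div.comp (hi.comp hp) (Primrec.const 2)
  have hsub : Primrec (fun q : (((ℕ × ℕ × ℕ) × ℕ) × ℕ) × ℕ => q.1.1.1.1.unpair.2 - 2) :=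
    Primrec.nat_sub.comp (hm.comp hp) (Primrec.const 2)
  have hR₁ := hR.comp (hc.pair (hsel.pair (hhalf.pair (hu.comp hp)))).to_comp
  have hR₂ := hR.comp (ha.pair (hb.pair (hsub.pair (hi.comp hp)))).to_comp
  exact Primrec.and.to_comp.comp hR₁ (Primrec.not.to_comp.comp hR₂)

theorem diagTable_eq_true {R : ℕ → ℕ → ℕ → ℕ → Bool} {z i t : ℕ} (hz : 2 ≤ z.unpair.2)
    (h : diagTable R z i t = true) :
    ∃ a ∈ eval (Denumerable.ofNat Code z.unpair.1) (Nat.pair z.unpair.1 0),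
    ∃ b ∈ eval (Denumerable.ofNat Code z.unpair.1) (Nat.pair z.unpair.1 1),
    ∃ c ∈ eval (Denumerable.ofNat Code z.unpair.1) z,
      R c (if i % 2 = 0 then a else b) (i / 2) t.unpair.2 = true ∧
        R a b (z.unpair.2 - 2) i = false := by
  have hz₂ : ¬ z.unpair.2 < 2 := by omega
  simp only [diagTable, hz₂, decide_false, cond_false, Option.getD_eq_iff, Option.bind_eq_some_iff,
    Option.map_eq_some_iff] at h
  obtain ⟨a, ha, b, hb, c, hc, h⟩ | ⟨-, h⟩ := h
  · refine ⟨a, evaln_sound ha, b, evaln_sound hb, c, evaln_sound hc, ?_⟩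
    simpa [Bool.cond_eq_ite] using h
  · cases h

theorem exists_row_diagTable {E : ℕ → ℕ → Prop} (hE : Equivalence E) {R : ℕ → ℕ → ℕ → ℕ → Bool}
    (hR : ∀ x y, E x y ↔ ∀ s, ∃ t, R x y s t = true) (z : ℕ) :
    ∃ i, ∀ t, diagTable R z i t = false := by
  by_cases hz : z.unpair.2 < 2
  · exact ⟨z.unpair.2, fun t => by simp [diagTable, hz]⟩
  by_contra! hcon
  have key : ∀ i, ∃ t, diagTable R z i t = true := by simpa using hcon
  obtain ⟨t, ht⟩ := key 0
  obtain ⟨a, ha, b, hb, c, hc, -⟩ := diagTable_eq_true (by omega) ht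
  have row : ∀ i, (∃ u, R c (if i % 2 = 0 then a else b) (i / 2) u = true) ∧
      R a b (z.unpair.2 - 2) i = false := by
    intro i
    obtain ⟨t, ht⟩ := key i
    obtain ⟨a₂, ha₂, b₂, hb₂, c₂, hc₂, h⟩ := diagTable_eq_true (by omega) ht
    obtain rfl := Part.mem_unique ha ha₂
    obtain rfl := Part.mem_unique hb hb₂
    obtain rfl := Part.mem_unique hc hc₂
    exact ⟨⟨_, h.1⟩, h.2⟩
  have hca : E c a := (hR c a).2 fun s => by simpa using (row (2 * s)).1
  have hcb : E c b := (hR c b).2 fun s => by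
    have h := (row (2 * s + 1)).1
    rwa [if_neg (by omega), show (2 * s + 1) / 2 = s by omega] at h
  obtain ⟨t, ht⟩ := (hR a b).1 (hE.trans (hE.symm hca) hcb) (z.unpair.2 - 2)
  simp [(row t).2] at ht

theorem exists_diagTable_eq_true {R : ℕ → ℕ → ℕ → ℕ → Bool} {f : ℕ → ℕ} {e : ℕ}
    (he : eval (Denumerable.ofNat Code e) = f) {s i u : ℕ}
    (hs : R (f (Nat.pair e 0)) (f (Nat.pair e 1)) s i = false)
    (hu : R (f (Nat.pair e (s + 2)))
      (if i % 2 = 0 then f (Nat.pair e 0) else f (Nat.pair e 1)) (i / 2) u = true) :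
    ∃ t, diagTable R (Nat.pair e (s + 2)) i t = true := by
  have conv : ∀ x, ∃ k, f x ∈ evaln k (Denumerable.ofNat Code e) x := fun x =>
    evaln_complete.1 (by rw [he]; exact Part.mem_some _)
  obtain ⟨k₀, h₀⟩ := conv (Nat.pair e 0)
  obtain ⟨k₁, h₁⟩ := conv (Nat.pair e 1)
  obtain ⟨k₂, h₂⟩ := conv (Nat.pair e (s + 2))
  refine ⟨Nat.pair (k₀ + k₁ + k₂) u, ?_⟩
  have hk₀ := Option.mem_def.1 (evaln_mono (show k₀ ≤ k₀ + k₁ + k₂ by omega) h₀)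
  have hk₁ := Option.mem_def.1 (evaln_mono (show k₁ ≤ k₀ + k₁ + k₂ by omega) h₁)
  have hk₂ := Option.mem_def.1 (evaln_mono (show k₂ ≤ k₀ + k₁ + k₂ by omega) h₂)
  simp [diagTable, Nat.unpair_pair, hk₀, hk₁, hk₂, hs, Bool.cond_eq_ite, hu]

/-- There is no Π⁰₂-complete equivalence relation. -/
theorem stmt_7 :
    ¬ ∃ E : ℕ → ℕ → Prop, Pi02Rel E ∧ Equivalence E ∧
      ∀ F : ℕ → ℕ → Prop, Pi02Rel F → Equivalence F →
        ComputablyReducible F E := by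
  rintro ⟨E, ⟨R, hRc, hR⟩, hE, hcomplete⟩
  have hex := exists_row_diagTable hE hR
  classical
  let p : ℕ → ℕ := fun z => Nat.find (hex z)
  let χ : ℕ → ℕ := fun z => Nat.pair z.unpair.1 (p z % 2)
  have hp : ∀ z t, diagTable R z (p z) t = false := fun z => Nat.find_spec (hex z)
  have hmin : ∀ z, ∀ j < p z, ∃ t, diagTable R z j t = true := fun z j hj => by
    simpa using Nat.find_min (hex z) hj
  have hpi : Pi02Rel (fun x y => χ x = χ y) := by
    refine pi02Rel_of_limit
      (g := fun z n => Nat.pair z.unpair.1 ((rowSearch (diagTable R z) n).1 % 2)) ?_ fun z => ?_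
    · exact Primrec₂.natPair.to_comp.comp
        (Primrec.fst.comp (Primrec.unpair.comp Primrec.fst)).to_comp
        (Primrec.nat_mod.to_comp.comp
          (Computable.fst.comp (computable_rowSearch (computable_diagTable hRc)))
          (Computable.const 2))
    · obtain ⟨N, hN⟩ := rowSearch_eventually_eq (hp z) (hmin z)
      exact ⟨N, fun n hn => by simp only [hN n hn, χ]⟩
  obtain ⟨f, hf, hred⟩ := hcomplete _ hpi ⟨fun _ => rfl, Eq.symm, Eq.trans⟩
  obtain ⟨c, hc⟩ := exists_code.1 (Partrec.nat_iff.1 hf)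
  let e := Encodable.encode c
  have he : eval (Denumerable.ofNat Code e) = f := by
    rw [Denumerable.ofNat_encode]; exact hc
  have hp0 : p (Nat.pair e 0) = 0 := by
    simp [p, diagTable]
  have hp1 : p (Nat.pair e 1) = 1 := by
    rw [Nat.find_eq_iff]
    simp [diagTable]
  have hab : ¬ E (f (Nat.pair e 0)) (f (Nat.pair e 1)) := by
    rw [← hred]
    simp [χ, hp0, hp1]
  rw [hR] at hab
  push Not at hab
  obtain ⟨s, hs⟩ := hab
  have hrow := hp (Nat.pair e (s + 2))
  have hEz : E (f (Nat.pair e (s + 2))) (if p (Nat.pair e (s + 2)) % 2 = 0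
      then f (Nat.pair e 0) else f (Nat.pair e 1)) := by
    split_ifs with h
    · rw [← hred]
      simp [χ, hp0, h]
    · rw [← hred]
      simp [χ, hp1, Nat.mod_two_ne_zero.1 h]
  obtain ⟨u, hu⟩ := (hR _ _).1 hEz (p (Nat.pair e (s + 2)) / 2)
  obtain ⟨t, ht⟩ := exists_diagTable_eq_true he (by simpa using hs _) hu
  simp [hrow t] at ht
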